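/- Assume (f_i)_{i=1}^N satisfies the open set condition and that p_i = (1 − p_0) t_i for all 1 ≤ i ≤ N (so that μ coincides with the self-similar measure associated with (f_i)_{i=1}^N and (t_i)_{i=1}^N). Then ξ_{1,r} > ξ_{2,r}, and consequently 0 < liminf_{n→∞} n^{1/ξ_{1,r}} e_{n,r}(μ) ≤ limsup_{n→∞} n^{1/ξ_{1,r}} e_{n,r}(μ) < ∞. -/

import Mathlib

open MeasureTheory Filter

/-- The `n`-th quantization error of order `r` of a Borel measure `P` on `ℝ^q`:
the infimum of `(∫ d(x,α)^r dP)^{1/r}` over finite sets `α` with `1 ≤ card α ≤ n`. -/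
noncomputable def quantErr {q : ℕ} (P : Measure (EuclideanSpace ℝ (Fin q)))
    (n : ℕ) (r : ℝ) : ℝ :=
  sInf ((fun α : Finset (EuclideanSpace ℝ (Fin q)) =>
      (∫ x, Metric.infDist x (α : Set (EuclideanSpace ℝ (Fin q))) ^ r ∂P) ^ (1 / r)) ''
    {α : Finset (EuclideanSpace ℝ (Fin q)) | α.Nonempty ∧ α.card ≤ n})

/-- Product of weights `g` along a word `σ` (equals `1` for the empty word). -/
noncomputable def prodw {N : ℕ} (g : Fin N → ℝ) (σ : List (Fin N)) : ℝ := (σ.map g).prod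

/-- The composition `f_{σ_1} ∘ ⋯ ∘ f_{σ_n}` along a word `σ`. -/
def wordMap {q N : ℕ} (f : Fin N → EuclideanSpace ℝ (Fin q) → EuclideanSpace ℝ (Fin q))
    (σ : List (Fin N)) : EuclideanSpace ℝ (Fin q) → EuclideanSpace ℝ (Fin q) :=
  σ.foldr (fun i g => f i ∘ g) id

/-- `h(σ) = h^{(1)}(σ) + h^{(2)}(σ)` where
`h^{(1)}(σ) = Σ_{j=0}^{|σ|-1} p0 p_{σ|_j} t_{σ^{(l)}_{-j}} s_σ^r` and `h^{(2)}(σ) = p_σ s_σ^r`. -/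
noncomputable def hfun {N : ℕ} (r p0 : ℝ) (s t p : Fin N → ℝ) (σ : List (Fin N)) : ℝ :=
  (∑ j ∈ Finset.range σ.length, p0 * prodw p (σ.take j) * prodw t (σ.drop j)) * prodw s σ ^ r
    + prodw p σ * prodw s σ ^ r

/-- `η̲_r := min_{1 ≤ i ≤ N} min{p0 t_i + p_i, t_i} · s_i^r`. -/
noncomputable def etaLow {N : ℕ} (r p0 : ℝ) (s t p : Fin N → ℝ) : ℝ :=
  ⨅ i, min (p0 * t i + p i) (t i) * s i ^ r

/-- The finite maximal antichain `Λ_{k,r} = {σ : h(σ|_{|σ|-1}) ≥ η̲_r/k > h(σ)}`. -/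
def Lam {N : ℕ} (r p0 : ℝ) (s t p : Fin N → ℝ) (k : ℕ) : Set (List (Fin N)) :=
  {σ | σ ≠ [] ∧ etaLow r p0 s t p / k ≤ hfun r p0 s t p σ.dropLast ∧
    hfun r p0 s t p σ < etaLow r p0 s t p / k}

/-- `a(x) = Σ_i (t_i s_i^r)^{x/(x+r)}` (also used for `b` with `p` in place of `t`). -/
noncomputable def afun {N : ℕ} (r : ℝ) (s t : Fin N → ℝ) (x : ℝ) : ℝ :=
  ∑ i, (t i * s i ^ r) ^ (x / (x + r))

section SimilarityWords

variable {q N : ℕ} {f : Fin N → EuclideanSpace ℝ (Fin q) → EuclideanSpace ℝ (Fin q)}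
  {s : Fin N → ℝ}

@[simp] lemma prodw_nil (g : Fin N → ℝ) : prodw g [] = 1 := by simp [prodw]

@[simp] lemma prodw_cons (g : Fin N → ℝ) (i : Fin N) (σ : List (Fin N)) :
    prodw g (i :: σ) = g i * prodw g σ := by simp [prodw]

@[simp] lemma prodw_append (g : Fin N → ℝ) (σ τ : List (Fin N)) :
    prodw g (σ ++ τ) = prodw g σ * prodw g τ := by simp [prodw]

lemma prodw_pos {g : Fin N → ℝ} (hg : ∀ i, 0 < g i) (σ : List (Fin N)) : 0 < prodw g σ := by
  induction σ with
  | nil => simp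
  | cons i σ ih => simpa using mul_pos (hg i) ih

lemma prodw_le_one {g : Fin N → ℝ} (hg : ∀ i, g i ∈ Set.Ioo (0 : ℝ) 1) (σ : List (Fin N)) :
    prodw g σ ≤ 1 := by
  induction σ with
  | nil => simp
  | cons i σ ih =>
    simpa using mul_le_one₀ (hg i).2.le (prodw_pos (fun i => (hg i).1) σ).le ih

lemma prodw_lt_one {g : Fin N → ℝ} (hg : ∀ i, g i ∈ Set.Ioo (0 : ℝ) 1) {σ : List (Fin N)}
    (hσ : σ ≠ []) : prodw g σ < 1 := by
  obtain ⟨i, σ, rfl⟩ := List.exists_cons_of_ne_nil hσ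
  rw [prodw_cons]
  exact mul_lt_one_of_nonneg_of_lt_one_left (hg i).1.le (hg i).2 (prodw_le_one hg σ)

@[simp] lemma wordMap_nil : wordMap f [] = id := rfl

@[simp] lemma wordMap_cons (i : Fin N) (σ : List (Fin N)) :
    wordMap f (i :: σ) = f i ∘ wordMap f σ := rfl

@[simp] lemma wordMap_append (σ τ : List (Fin N)) :
    wordMap f (σ ++ τ) = wordMap f σ ∘ wordMap f τ := by
  induction σ with
  | nil => simp
  | cons i σ ih => simp [ih, Function.comp_assoc]

lemma dist_wordMap (hf : ∀ i x y, dist (f i x) (f i y) = s i * dist x y) (σ : List (Fin N))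
    (x y : EuclideanSpace ℝ (Fin q)) :
    dist (wordMap f σ x) (wordMap f σ y) = prodw s σ * dist x y := by
  induction σ with
  | nil => simp
  | cons i σ ih => simp [hf, ih, mul_assoc]

/-- A similitude of a finite-dimensional Euclidean space is onto. -/
lemma surjective_of_dist_eq_mul {g : EuclideanSpace ℝ (Fin q) → EuclideanSpace ℝ (Fin q)} {c : ℝ}
    (hc : 0 < c) (hg : ∀ x y, dist (g x) (g y) = c * dist x y) : Function.Surjective g := by
  have hiso : Isometry fun x => c⁻¹ • g x := by
    refine Isometry.of_dist_eq fun x y => ?_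
    rw [dist_smul₀, hg, Real.norm_eq_abs, abs_of_pos (inv_pos.2 hc), inv_mul_cancel_left₀ hc.ne']
  have hsurj : Function.Surjective hiso.affineIsometryOfStrictConvexSpace := by
    set A := hiso.affineIsometryOfStrictConvexSpace
    have : Function.Surjective A.linear :=
      LinearMap.injective_iff_surjective.1 A.linearIsometry.injective
    exact A.toAffineMap.linear_surjective_iff.1 this
  intro y
  obtain ⟨x, hx⟩ := hsurj (c⁻¹ • y)
  refine ⟨x, ?_⟩
  have hx' : c⁻¹ • g x = c⁻¹ • y := by simpa using hx
  exact smul_right_injective _ (inv_ne_zero hc.ne') hx'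

lemma disjoint_wordMap_image (hs : ∀ i, s i ∈ Set.Ioo (0 : ℝ) 1)
    (hf : ∀ i x y, dist (f i x) (f i y) = s i * dist x y)
    {U : Set (EuclideanSpace ℝ (Fin q))} (hU : ∀ i, f i '' U ⊆ U)
    (hd : Pairwise fun i j => Disjoint (f i '' U) (f j '' U)) (σ τ : List (Fin N))
    (h₁ : ¬ σ <+: τ) (h₂ : ¬ τ <+: σ) :
    Disjoint (wordMap f σ '' U) (wordMap f τ '' U) := by
  have hsub : ∀ σ : List (Fin N), wordMap f σ '' U ⊆ U := by
    intro σ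
    induction σ with
    | nil => simp
    | cons i σ ih =>
      rw [wordMap_cons, Set.image_comp]
      exact (Set.image_mono ih).trans (hU i)
  induction σ generalizing τ with
  | nil => exact absurd List.nil_prefix h₁
  | cons a σ ih =>
    cases τ with
    | nil => exact absurd List.nil_prefix h₂
    | cons b τ =>
      rw [wordMap_cons, wordMap_cons, Set.image_comp, Set.image_comp]
      by_cases hab : a = b
      · subst hab
        have hinj : Function.Injective (f a) := by
          intro x y hxy
          have := hf a x y
          rw [hxy, dist_self] at this
          exact dist_eq_zero.1 ((mul_eq_zero.1 this.symm).resolve_left (hs a).1.ne')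
        rw [Set.disjoint_image_iff hinj]
        refine ih τ (fun h => h₁ ?_) (fun h => h₂ ?_) <;> simpa using h
      · exact (hd hab).mono (Set.image_mono (hsub σ)) (Set.image_mono (hsub τ))

lemma exists_prefix_prodw_mem_Icc (hs : ∀ i, s i ∈ Set.Ioo (0 : ℝ) 1) {m : ℝ}
    (hm : 0 < m) (hm1 : m ≤ 1) (hms : ∀ i, m ≤ s i) (w : List (Fin N)) {ρ : ℝ} (hρ1 : ρ ≤ 1)
    (hρ : prodw s w ≤ ρ) : ∃ v, v <+: w ∧ prodw s v ∈ Set.Icc (m * ρ) ρ := by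
  induction w generalizing ρ with
  | nil =>
    rw [prodw_nil] at hρ
    exact ⟨[], List.nil_prefix, by simpa using mul_le_one₀ hm1 (by linarith) hρ1, by simpa⟩
  | cons a w ih =>
    rw [prodw_cons] at hρ
    rcases le_or_gt (s a) ρ with h | h
    · refine ⟨[a], by simp, ?_, by simpa⟩
      have := hms a
      simp only [prodw_cons, prodw_nil, mul_one]
      nlinarith
    · have ha := (hs a).1
      obtain ⟨v, hv, h1, h2⟩ := ih (ρ := ρ / s a) ((div_le_one ha).2 h.le)
        ((le_div_iff₀ ha).2 (by linarith))
      refine ⟨a :: v, by simpa using hv, ?_, ?_⟩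
      · rw [prodw_cons]
        calc m * ρ = s a * (m * (ρ / s a)) := by field_simp
          _ ≤ _ := by gcongr
      · rw [prodw_cons]
        calc s a * prodw s v ≤ s a * (ρ / s a) := by gcongr
          _ = ρ := by field_simp

lemma exists_pos_le_one_forall_le {g : Fin N → ℝ} (hg : ∀ i, 0 < g i) :
    ∃ m, 0 < m ∧ m ≤ 1 ∧ ∀ i, m ≤ g i := by
  cases isEmpty_or_nonempty (Fin N)
  · exact ⟨1, one_pos, le_rfl, isEmptyElim⟩
  · obtain ⟨i, hi⟩ := Finite.exists_min g
    exact ⟨min (g i) 1, lt_min (hg i) one_pos, min_le_right _ _,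
      fun j => (min_le_left _ _).trans (hi j)⟩

lemma exists_lt_one_forall_le {g : Fin N → ℝ} (hg : ∀ i, g i < 1) : ∃ b < 1, ∀ i, g i ≤ b := by
  obtain ⟨m, hm, -, h⟩ := exists_pos_le_one_forall_le fun i => sub_pos.2 (hg i)
  exact ⟨1 - m, by linarith, fun i => by linarith [h i]⟩

/-- `A` is an antichain of words of contraction ratio comparable to that of `k`, whose images of
the origin are near the one of `k`. -/
def IsNeighborAntichain (f : Fin N → EuclideanSpace ℝ (Fin q) → EuclideanSpace ℝ (Fin q))
    (s : Fin N → ℝ) (m L : ℝ) (k : List (Fin N)) (A : Finset (List (Fin N))) : Prop :=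
  IsAntichain (· <+: ·) (A : Set (List (Fin N))) ∧
    ∀ i ∈ A, prodw s i ∈ Set.Icc (m * prodw s k) (prodw s k) ∧
      dist (wordMap f i 0) (wordMap f k 0) ≤ L * prodw s k

lemma exists_card_le_of_isNeighborAntichain (hs : ∀ i, s i ∈ Set.Ioo (0 : ℝ) 1)
    (hf : ∀ i x y, dist (f i x) (f i y) = s i * dist x y)
    {U : Set (EuclideanSpace ℝ (Fin q))} (hUne : U.Nonempty) (hUo : IsOpen U)
    (hU : ∀ i, f i '' U ⊆ U) (hd : Pairwise fun i j => Disjoint (f i '' U) (f j '' U))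
    {m : ℝ} (hm : 0 < m) (L : ℝ) :
    ∃ M : ℕ, ∀ k A, IsNeighborAntichain f s m L k A → A.card ≤ M := by
  obtain ⟨u, hu⟩ := hUne
  obtain ⟨ρ, hρ, hball⟩ := Metric.isOpen_iff.1 hUo u hu
  have hspos := prodw_pos fun i => (hs i).1
  obtain ⟨T, hTfin, hT⟩ := Metric.totallyBounded_iff.1
    (isCompact_closedBall (0 : EuclideanSpace ℝ (Fin q)) (‖u‖ + L)).totallyBounded
    (ρ * m / 2) (by positivity)
  refine ⟨hTfin.toFinset.card, fun k A hA => ?_⟩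
  have hk := hspos k
  set y : List (Fin N) → EuclideanSpace ℝ (Fin q) := fun i =>
    (prodw s k)⁻¹ • (wordMap f i u - wordMap f k 0) with hy
  have hcover : ∀ i ∈ A, ∃ z ∈ T, dist (y i) z < ρ * m / 2 := by
    intro i hi
    obtain ⟨⟨-, h1⟩, h2⟩ := hA.2 i hi
    have hmem : y i ∈ Metric.closedBall (0 : EuclideanSpace ℝ (Fin q)) (‖u‖ + L) := by
      rw [mem_closedBall_zero_iff, hy, norm_smul, Real.norm_eq_abs, abs_of_pos (inv_pos.2 hk),
        ← dist_eq_norm, inv_mul_le_iff₀ hk]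
      have h3 := dist_wordMap hf i u 0
      rw [dist_zero_right] at h3
      have h4 := dist_triangle (wordMap f i u) (wordMap f i 0) (wordMap f k 0)
      nlinarith [norm_nonneg u]
    simpa using hT hmem
  choose! z hzT hz using hcover
  refine Finset.card_le_card_of_injOn z (fun i hi => by simpa using hzT i hi) ?_
  intro i hi l hl hil
  by_contra hne
  have hdisj := disjoint_wordMap_image hs hf hU hd i l (hA.1 hi hl hne) (hA.1 hl hi (Ne.symm hne))
  have hdist : dist (y i) (y l) < ρ * m := by
    have h1 := hz i hi
    have h2 := hz l hl
    rw [← hil] at h2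
    linarith [dist_triangle_right (y i) (y l) (z i)]
  rw [hy, dist_smul₀, dist_sub_right, Real.norm_eq_abs, abs_of_pos (inv_pos.2 hk),
    inv_mul_lt_iff₀ hk] at hdist
  obtain ⟨x, hx⟩ := surjective_of_dist_eq_mul (hspos i) (dist_wordMap hf i) (wordMap f l u)
  have hxu : x ∈ U := by
    apply hball
    rw [Metric.mem_ball, dist_comm]
    refine lt_of_mul_lt_mul_left ?_ (hspos i).le
    rw [← dist_wordMap hf, hx]
    have := (hA.2 i hi).1.1
    nlinarith
  exact Set.disjoint_left.1 hdisj ⟨x, hxu, rfl⟩ (hx ▸ ⟨u, hu, rfl⟩)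

/-- Under the open set condition, a suitable suffix `k` separates the images along incomparable
words by a multiple of the larger contraction ratio. -/
lemma exists_suffix_separating (hs : ∀ i, s i ∈ Set.Ioo (0 : ℝ) 1)
    (hf : ∀ i x y, dist (f i x) (f i y) = s i * dist x y)
    {U : Set (EuclideanSpace ℝ (Fin q))} (hUne : U.Nonempty) (hUo : IsOpen U)
    (hU : ∀ i, f i '' U ⊆ U) (hd : Pairwise fun i j => Disjoint (f i '' U) (f j '' U))
    {m : ℝ} (hm : 0 < m) (hm1 : m ≤ 1) (hms : ∀ i, m ≤ s i)
    {R : ℝ} (hR : ∀ w, ‖wordMap f w 0‖ ≤ R) (L : ℝ) :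
    ∃ k, ∀ σ τ, ¬ σ <+: τ → ¬ τ <+: σ → prodw s (τ ++ k) ≤ prodw s (σ ++ k) →
      (L - R) * prodw s (σ ++ k) ≤ dist (wordMap f (σ ++ k) 0) (wordMap f (τ ++ k) 0) := by
  classical
  have hspos := prodw_pos fun i => (hs i).1
  obtain ⟨M, hM⟩ := exists_card_le_of_isNeighborAntichain hs hf hUne hUo hU hd hm L
  obtain ⟨k, A, hA, hmax⟩ : ∃ k A, IsNeighborAntichain f s m L k A ∧
      ∀ k' A', IsNeighborAntichain f s m L k' A' → A'.card ≤ A.card := by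
    let S : Set ℕ := {c | ∃ k A, IsNeighborAntichain f s m L k A ∧ A.card = c}
    have hne : S.Nonempty := ⟨0, [], ∅, ⟨by simp, by simp⟩, rfl⟩
    have hbdd : BddAbove S := ⟨M, by rintro _ ⟨k, A, hA, rfl⟩; exact hM k A hA⟩
    obtain ⟨k, A, hA, hc⟩ := Nat.sSup_mem hne hbdd
    exact ⟨k, A, hA, fun k' A' hA' => hc ▸ le_csSup hbdd ⟨k', A', hA', rfl⟩⟩
  refine ⟨k, fun σ τ hστ hτσ hle => ?_⟩
  by_contra! hlt
  obtain ⟨v, ⟨w, hvw⟩, hv⟩ := exists_prefix_prodw_mem_Icc hs hm hm1 hms (τ ++ k)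
    (prodw_le_one hs (σ ++ k)) hle
  have hσv : ¬ σ <+: v := fun h => by
    have h1 : σ <+: τ ++ k := h.trans ⟨w, hvw⟩
    rcases List.prefix_or_prefix_of_prefix h1 (List.prefix_append τ k) with h | h
    exacts [hστ h, hτσ h]
  have hvσ : ¬ v <+: σ := by
    rintro ⟨w', rfl⟩
    have h1 := hv.2
    rw [List.append_assoc, prodw_append] at h1
    have hw : w' ++ k = [] := by
      by_contra hw
      have := prodw_lt_one hs hw
      nlinarith [hspos v]
    have : w' = [] := (List.append_eq_nil_iff.1 hw).1
    exact hσv (by simp [this])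
  have hnear : dist (wordMap f v 0) (wordMap f (σ ++ k) 0) ≤ L * prodw s (σ ++ k) := by
    have h1 : dist (wordMap f v 0) (wordMap f (τ ++ k) 0) ≤ R * prodw s (σ ++ k) := by
      rw [← hvw, wordMap_append, Function.comp_apply, dist_wordMap hf, dist_zero_left, mul_comm]
      exact mul_le_mul (hR w) hv.2 (hspos v).le ((norm_nonneg _).trans (hR []))
    have h2 := dist_triangle_right (wordMap f v 0) (wordMap f (σ ++ k) 0) (wordMap f (τ ++ k) 0)
    nlinarith
  have hinc : ∀ a : List (Fin N), ¬ v <+: σ ++ a ∧ ¬ σ ++ a <+: v := fun a =>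
    ⟨fun h => (List.prefix_or_prefix_of_prefix h (List.prefix_append σ a)).elim hvσ hσv,
      fun h => hσv ((List.prefix_append σ a).trans h)⟩
  have hvA : v ∉ A.image (σ ++ ·) := by
    simp only [Finset.mem_image, not_exists, not_and]
    rintro a - rfl
    exact hσv (List.prefix_append σ a)
  have hnew : IsNeighborAntichain f s m L (σ ++ k) (insert v (A.image (σ ++ ·))) := by
    refine ⟨?_, ?_⟩
    · rw [Finset.coe_insert, Finset.coe_image]
      refine IsAntichain.insert ?_ ?_ ?_
      · rintro _ ⟨a, ha, rfl⟩ _ ⟨b, hb, rfl⟩ hab h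
        exact hA.1 ha hb (fun e => hab (by rw [e])) ((List.prefix_append_right_inj σ).1 h)
      · rintro _ ⟨a, ha, rfl⟩ -
        exact (hinc a).2
      · rintro _ ⟨a, ha, rfl⟩ -
        exact (hinc a).1
    · intro i hi
      rcases Finset.mem_insert.1 hi with rfl | hi
      · exact ⟨hv, hnear⟩
      · obtain ⟨a, ha, rfl⟩ := Finset.mem_image.1 hi
        obtain ⟨⟨h1, h2⟩, h3⟩ := hA.2 a ha
        have hσ := hspos σ
        simp only [prodw_append, wordMap_append, Function.comp_apply, dist_wordMap hf]
        refine ⟨⟨?_, ?_⟩, ?_⟩ <;> nlinarith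
  have hcard := hmax _ _ hnew
  rw [Finset.card_insert_of_notMem hvA,
    Finset.card_image_of_injective _ (List.append_right_injective σ)] at hcard
  omega

lemma exists_antichain_card_ge {η : Fin N → ℝ} {x c : ℝ} (hη : ∀ i, η i ∈ Set.Ioo (0 : ℝ) 1)
    (hx : 0 ≤ x) (hsum : ∑ i, η i ^ x = 1) (hc : 0 < c) (hcη : ∀ i, c ≤ η i) {b : ℝ}
    (hηb : ∀ i, η i ≤ b) (n : ℕ) {ε : ℝ} (hε : 0 < ε) (hnε : b ^ n ≤ ε)
    (hεc : c * ε ≤ 1) :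
    ∃ Γ : Finset (List (Fin N)), IsAntichain (· <+: ·) (Γ : Set (List (Fin N))) ∧
      (∀ σ ∈ Γ, c * ε ≤ prodw η σ) ∧ ε ^ (-x) ≤ Γ.card := by
  classical
  induction n generalizing ε with
  | zero =>
    refine ⟨{[]}, by simp, by simpa using hεc, ?_⟩
    simpa using Real.rpow_le_one_of_one_le_of_nonpos (by simpa using hnε) (neg_nonpos.2 hx)
  | succ n ih =>
    rcases le_or_gt 1 ε with h1 | h1
    · refine ⟨{[]}, by simp, by simpa using hεc, ?_⟩
      simpa using Real.rpow_le_one_of_one_le_of_nonpos h1 (neg_nonpos.2 hx)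
    · have hstep : ∀ i, ∃ Γ : Finset (List (Fin N)),
          IsAntichain (· <+: ·) (Γ : Set (List (Fin N))) ∧
          (∀ σ ∈ Γ, c * (ε / η i) ≤ prodw η σ) ∧ (ε / η i) ^ (-x) ≤ Γ.card := by
        intro i
        have hi := (hη i).1
        refine ih (by positivity) ?_ ?_
        · rw [le_div_iff₀ hi]
          refine le_trans ?_ hnε
          rw [pow_succ]
          exact mul_le_mul_of_nonneg_left (hηb i) (pow_nonneg (hi.le.trans (hηb i)) n)
        · rw [← mul_div_assoc, div_le_one hi]
          nlinarith [hcη i]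
      choose Γ hanti hlow hcard using hstep
      refine ⟨Finset.univ.biUnion fun i => (Γ i).image (i :: ·), ?_, ?_, ?_⟩
      · intro σ hσ τ hτ hne hpre
        simp only [Finset.coe_biUnion, Finset.coe_univ, Set.mem_univ, Set.iUnion_true,
          Finset.coe_image, Set.mem_iUnion, Set.mem_image, Finset.mem_coe] at hσ hτ
        obtain ⟨i, σ, hσ, rfl⟩ := hσ
        obtain ⟨j, τ, hτ, rfl⟩ := hτ
        obtain ⟨rfl, hpre'⟩ := List.cons_prefix_cons.1 hpre
        exact hanti i hσ hτ (fun e => hne (by rw [e])) hpre'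
      · intro σ hσ
        simp only [Finset.mem_biUnion, Finset.mem_univ, true_and, Finset.mem_image] at hσ
        obtain ⟨i, σ, hσ, rfl⟩ := hσ
        have hi := (hη i).1
        rw [prodw_cons]
        calc c * ε = η i * (c * (ε / η i)) := by field_simp
          _ ≤ _ := mul_le_mul_of_nonneg_left (hlow i σ hσ) hi.le
      · rw [Finset.card_biUnion]
        · push_cast
          calc ε ^ (-x) = ∑ i, (ε / η i) ^ (-x) := by
                have : ∀ i, (ε / η i) ^ (-x) = ε ^ (-x) * η i ^ x := fun i => by
                  rw [Real.div_rpow hε.le (hη i).1.le, Real.rpow_neg (hη i).1.le, div_inv_eq_mul]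
                simp_rw [this, ← Finset.mul_sum, hsum, mul_one]
            _ ≤ _ := by
                refine Finset.sum_le_sum fun i _ => ?_
                rw [Finset.card_image_of_injective _ (List.cons_injective)]
                exact hcard i
        · intro i _ j _ hij
          rw [Function.onFun, Finset.disjoint_left]
          rintro _ h1 h2
          obtain ⟨a, -, rfl⟩ := Finset.mem_image.1 h1
          obtain ⟨b, -, hb⟩ := Finset.mem_image.1 h2
          exact hij (List.cons.inj hb).1.symm

lemma prodw_mul_rpow {t : Fin N → ℝ} (hs : ∀ i, 0 < s i) (r : ℝ) (σ : List (Fin N)) :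
    prodw (fun i => t i * s i ^ r) σ = prodw t σ * prodw s σ ^ r := by
  induction σ with
  | nil => simp
  | cons i σ ih =>
    rw [prodw_cons, prodw_cons, prodw_cons, ih, Real.mul_rpow (hs i).le (prodw_pos hs σ).le]
    ring

lemma norm_wordMap_le (hs : ∀ i, 0 < s i)
    (hf : ∀ i x y, dist (f i x) (f i y) = s i * dist x y) {R : ℝ}
    (hR : ∀ i, ‖f i 0‖ ≤ (1 - s i) * R) (w : List (Fin N)) {x : EuclideanSpace ℝ (Fin q)}
    (hx : ‖x‖ ≤ R) : ‖wordMap f w x‖ ≤ R := by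
  induction w with
  | nil => simpa
  | cons i w ih =>
    have h1 := hf i (wordMap f w x) 0
    rw [dist_zero_right, dist_eq_norm] at h1
    have h2 := norm_sub_norm_le (f i (wordMap f w x)) (f i 0)
    simp only [wordMap_cons, Function.comp_apply]
    nlinarith [hR i, mul_le_mul_of_nonneg_left ih (hs i).le]

end SimilarityWords

section SelfSimilarMeasure

variable {q N : ℕ} {f : Fin N → EuclideanSpace ℝ (Fin q) → EuclideanSpace ℝ (Fin q)}
  {s t : Fin N → ℝ} {ν : Measure (EuclideanSpace ℝ (Fin q))}

lemma continuous_of_dist_eq_mul (hs : ∀ i, 0 < s i)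
    (hf : ∀ i x y, dist (f i x) (f i y) = s i * dist x y) (i : Fin N) : Continuous (f i) :=
  (LipschitzWith.of_dist_le_mul (K := ⟨s i, (hs i).le⟩) fun x y => (hf i x y).le).continuous

lemma exists_invariant_ball (hs : ∀ i, s i ∈ Set.Ioo (0 : ℝ) 1)
    (f : Fin N → EuclideanSpace ℝ (Fin q) → EuclideanSpace ℝ (Fin q))
    (hνc : ∃ K, IsCompact K ∧ ν Kᶜ = 0) :
    ∃ R, 0 < R ∧ (∀ i, ‖f i 0‖ ≤ (1 - s i) * R) ∧ ν (Metric.closedBall 0 R)ᶜ = 0 := by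
  obtain ⟨K, hK, hν⟩ := hνc
  obtain ⟨R₀, hR₀⟩ := hK.isBounded.subset_closedBall (0 : EuclideanSpace ℝ (Fin q))
  have hnn : ∀ i, 0 ≤ ‖f i 0‖ / (1 - s i) := fun i =>
    div_nonneg (norm_nonneg _) (by linarith [(hs i).2])
  have hS : 0 ≤ ∑ i, ‖f i 0‖ / (1 - s i) := Finset.sum_nonneg fun i _ => hnn i
  refine ⟨1 + |R₀| + ∑ i, ‖f i 0‖ / (1 - s i), by positivity, fun i => ?_, ?_⟩
  · have h1 : 0 < 1 - s i := by linarith [(hs i).2]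
    rw [mul_comm, ← div_le_iff₀ h1]
    have := Finset.single_le_sum (fun i _ => hnn i) (Finset.mem_univ i)
    linarith [abs_nonneg R₀]
  · refine measure_mono_null (Set.compl_subset_compl.2 (hR₀.trans ?_)) hν
    exact Metric.closedBall_subset_closedBall (by linarith [le_abs_self R₀])

lemma integrable_infDist_rpow [IsFiniteMeasure ν] (hνc : ∃ K, IsCompact K ∧ ν Kᶜ = 0)
    {r : ℝ} (hr : 0 < r) (α : Set (EuclideanSpace ℝ (Fin q))) :
    Integrable (fun x => Metric.infDist x α ^ r) ν := by
  obtain ⟨K, hK, hν⟩ := hνc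
  have hcont : Continuous fun x : EuclideanSpace ℝ (Fin q) => Metric.infDist x α ^ r :=
    (Metric.continuous_infDist_pt α).rpow_const fun _ => Or.inr hr.le
  have h := hcont.continuousOn.integrableOn_compact (μ := ν) hK
  rwa [IntegrableOn, Measure.restrict_eq_self_of_ae_mem (mem_ae_iff.2 hν)] at h

lemma ofReal_prodw_mul_measure_preimage_le (hf : ∀ i, Measurable (f i)) (ht : ∀ i, 0 < t i)
    (hνss : ν = ∑ i, ENNReal.ofReal (t i) • ν.map (f i)) (w : List (Fin N))
    {A : Set (EuclideanSpace ℝ (Fin q))} (hA : MeasurableSet A) :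
    ENNReal.ofReal (prodw t w) * ν (wordMap f w ⁻¹' A) ≤ ν A := by
  induction w generalizing A with
  | nil => simp
  | cons i w ih =>
    have h1 : ENNReal.ofReal (t i) * ν (f i ⁻¹' A) ≤ ν A := by
      conv_rhs => rw [hνss]
      rw [Measure.finsetSum_apply]
      refine le_trans (le_of_eq ?_) (Finset.single_le_sum (fun _ _ => zero_le) (Finset.mem_univ i))
      rw [Measure.smul_apply, Measure.map_apply (hf i) hA, smul_eq_mul]
    rw [prodw_cons, ENNReal.ofReal_mul (ht i).le, mul_assoc, wordMap_cons, Set.preimage_comp]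
    exact (mul_le_mul_right (ih (hf i hA)) _).trans h1

/-- The inhomogeneous self-similar measure with condensation measure `ν` and weights proportional
to those of the self-similar measure `ν` is `ν` itself. -/
lemma eq_of_inhomogeneous_selfSimilar [IsProbabilityMeasure ν]
    {μ : Measure (EuclideanSpace ℝ (Fin q))} [IsProbabilityMeasure μ]
    (hf : ∀ i, Measurable (f i)) (ht : ∀ i, 0 < t i) (ht1 : ∑ i, t i = 1)
    (hνss : ν = ∑ i, ENNReal.ofReal (t i) • ν.map (f i)) {p0 : ℝ} (hp0 : 0 < p0) (hp1 : p0 < 1)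
    (hμss : μ = ENNReal.ofReal p0 • ν +
      ∑ i, ENNReal.ofReal ((1 - p0) * t i) • μ.map (f i)) : μ = ν := by
  have hν : ∀ A, MeasurableSet A → ν.real A = ∑ i, t i * ν.real (f i ⁻¹' A) := by
    intro A hA
    conv_lhs => rw [hνss]
    simp only [Measure.real, Measure.finsetSum_apply, Measure.smul_apply, smul_eq_mul]
    rw [ENNReal.toReal_sum fun i _ => ?_]
    · refine Finset.sum_congr rfl fun i _ => ?_
      rw [ENNReal.toReal_mul, ENNReal.toReal_ofReal (ht i).le, Measure.map_apply (hf i) hA]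
    · rw [Measure.map_apply (hf i) hA]; finiteness
  have hμ : ∀ A, MeasurableSet A →
      μ.real A = p0 * ν.real A + ∑ i, (1 - p0) * t i * μ.real (f i ⁻¹' A) := by
    intro A hA
    conv_lhs => rw [hμss]
    simp only [Measure.real, Measure.add_apply, Measure.finsetSum_apply, Measure.smul_apply,
      smul_eq_mul]
    have hfin : ∀ i, ENNReal.ofReal ((1 - p0) * t i) * (μ.map (f i)) A ≠ ⊤ := fun i => by
      rw [Measure.map_apply (hf i) hA]; finiteness
    rw [ENNReal.toReal_add (by finiteness) (ENNReal.sum_ne_top.2 fun i _ => hfin i),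
      ENNReal.toReal_sum fun i _ => hfin i, ENNReal.toReal_mul, ENNReal.toReal_ofReal hp0.le]
    congr 1
    refine Finset.sum_congr rfl fun i _ => ?_
    rw [ENNReal.toReal_mul, ENNReal.toReal_ofReal (mul_nonneg (by linarith) (ht i).le),
      Measure.map_apply (hf i) hA]
  have hbound : ∀ n : ℕ, ∀ A, MeasurableSet A → |μ.real A - ν.real A| ≤ (1 - p0) ^ n := by
    intro n
    induction n with
    | zero =>
      intro A _
      rw [pow_zero, abs_le]
      constructor <;> linarith [measureReal_nonneg (μ := μ) (s := A),
        measureReal_nonneg (μ := ν) (s := A), measureReal_le_one (μ := μ) (s := A),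
        measureReal_le_one (μ := ν) (s := A)]
    | succ n ih =>
      intro A hA
      have h1 : μ.real A - ν.real A =
          ∑ i, (1 - p0) * t i * (μ.real (f i ⁻¹' A) - ν.real (f i ⁻¹' A)) := by
        have h2 : ν.real A = p0 * ν.real A + (1 - p0) * ∑ i, t i * ν.real (f i ⁻¹' A) := by
          rw [← hν A hA]; ring
        rw [hμ A hA]
        simp only [mul_sub, Finset.sum_sub_distrib, mul_assoc, ← Finset.mul_sum]
        linarith
      rw [h1]
      calc _ ≤ ∑ i, |(1 - p0) * t i * (μ.real (f i ⁻¹' A) - ν.real (f i ⁻¹' A))| :=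
            Finset.abs_sum_le_sum_abs _ _
        _ ≤ ∑ i, (1 - p0) * t i * (1 - p0) ^ n := by
            refine Finset.sum_le_sum fun i _ => ?_
            have h3 : 0 ≤ (1 - p0) * t i := mul_nonneg (by linarith) (ht i).le
            rw [abs_mul, abs_of_nonneg h3]
            exact mul_le_mul_of_nonneg_left (ih _ (hf i hA)) h3
        _ = (1 - p0) ^ (n + 1) := by
            rw [← Finset.sum_mul, ← Finset.mul_sum, ht1]; ring
  refine Measure.ext fun A hA => ?_
  have hlim : Tendsto (fun n : ℕ => (1 - p0) ^ n) atTop (nhds 0) :=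
    tendsto_pow_atTop_nhds_zero_of_lt_one (by linarith) (by linarith)
  have h0 : |μ.real A - ν.real A| ≤ 0 := ge_of_tendsto' hlim fun n => hbound n A hA
  have h1 : μ.real A = ν.real A := sub_eq_zero.1 (abs_nonpos_iff.1 h0)
  exact (ENNReal.toReal_eq_toReal_iff' (by finiteness) (by finiteness)).1 h1

lemma integral_infDist_rpow_le_sum [IsFiniteMeasure ν] (hνc : ∃ K, IsCompact K ∧ ν Kᶜ = 0)
    (hs : ∀ i, 0 < s i) (hf : ∀ i x y, dist (f i x) (f i y) = s i * dist x y)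
    (ht : ∀ i, 0 < t i) (hνss : ν = ∑ i, ENNReal.ofReal (t i) • ν.map (f i))
    {r : ℝ} (hr : 0 < r) {α : Set (EuclideanSpace ℝ (Fin q))}
    {β : Fin N → Set (EuclideanSpace ℝ (Fin q))} (hβ : ∀ i, (β i).Nonempty)
    (hβα : ∀ i, f i '' β i ⊆ α) :
    ∫ x, Metric.infDist x α ^ r ∂ν ≤
      ∑ i, t i * s i ^ r * ∫ x, Metric.infDist x (β i) ^ r ∂ν := by
  have hcont := continuous_of_dist_eq_mul hs hf
  have hd : Continuous fun x : EuclideanSpace ℝ (Fin q) => Metric.infDist x α ^ r :=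
    (Metric.continuous_infDist_pt α).rpow_const fun _ => Or.inr hr.le
  have hpt : ∀ i x, Metric.infDist (f i x) α ≤ s i * Metric.infDist x (β i) := by
    intro i x
    rw [← div_le_iff₀' (hs i), Metric.le_infDist (hβ i)]
    intro y hy
    rw [div_le_iff₀' (hs i), ← hf]
    exact Metric.infDist_le_dist_of_mem (hβα i ⟨y, hy, rfl⟩)
  have hle : ∀ i x, Metric.infDist (f i x) α ^ r ≤ s i ^ r * Metric.infDist x (β i) ^ r := by
    intro i x
    rw [← Real.mul_rpow (hs i).le Metric.infDist_nonneg]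
    exact Real.rpow_le_rpow Metric.infDist_nonneg (hpt i x) hr.le
  have hint : ∀ i, Integrable (fun x => Metric.infDist (f i x) α ^ r) ν := by
    intro i
    refine ((integrable_infDist_rpow hνc hr (β i)).const_mul (s i ^ r)).mono'
      (hd.comp (hcont i)).aestronglyMeasurable (Eventually.of_forall fun x => ?_)
    rw [Real.norm_of_nonneg (Real.rpow_nonneg Metric.infDist_nonneg r)]
    exact hle i x
  conv_lhs => rw [hνss]
  rw [integral_finsetSum_measure fun i _ => ?_]
  · refine Finset.sum_le_sum fun i _ => ?_
    rw [integral_smul_measure, ENNReal.toReal_ofReal (ht i).le, smul_eq_mul, mul_assoc,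
      integral_map (hcont i).aemeasurable hd.aestronglyMeasurable,
      ← integral_const_mul (s i ^ r)]
    refine mul_le_mul_of_nonneg_left ?_ (ht i).le
    exact integral_mono (hint i) ((integrable_infDist_rpow hνc hr (β i)).const_mul _) (hle i)
  · refine Integrable.smul_measure ?_ ENNReal.ofReal_ne_top
    exact (integrable_map_measure hd.aestronglyMeasurable (hcont i).aemeasurable).2 (hint i)

lemma exists_finset_integral_infDist_rpow_le [IsFiniteMeasure ν]
    (hνc : ∃ K, IsCompact K ∧ ν Kᶜ = 0)
    (hs : ∀ i, 0 < s i) (hf : ∀ i x y, dist (f i x) (f i y) = s i * dist x y)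
    (ht : ∀ i, 0 < t i) (hνss : ν = ∑ i, ENNReal.ofReal (t i) • ν.map (f i))
    {r : ℝ} (hr : 0 < r) {x c : ℝ} (hη : ∀ i, t i * s i ^ r ∈ Set.Ioo (0 : ℝ) 1)
    (hx : 0 ≤ x) (hx1 : x ≤ 1) (hsum : ∑ i, (t i * s i ^ r) ^ x = 1) (hc : 0 < c)
    (hcη : ∀ i, c ≤ t i * s i ^ r) {b : ℝ} (hηb : ∀ i, t i * s i ^ r ≤ b) (hN : 0 < N)
    (n : ℕ) {ε : ℝ} (hε : 0 < ε) (hnε : b ^ n ≤ ε) (hεc : c * ε ≤ 1) :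
    ∃ α : Finset (EuclideanSpace ℝ (Fin q)), α.Nonempty ∧ (α.card : ℝ) ≤ (c * ε) ^ (-x) ∧
      ∫ y, Metric.infDist y (α : Set (EuclideanSpace ℝ (Fin q))) ^ r ∂ν ≤
        (∫ y, Metric.infDist y {0} ^ r ∂ν) * ε ^ (1 - x) := by
  classical
  have hbase : ∀ ε : ℝ, c * ε ≤ 1 → 1 ≤ ε →
      ∃ α : Finset (EuclideanSpace ℝ (Fin q)), α.Nonempty ∧ (α.card : ℝ) ≤ (c * ε) ^ (-x) ∧
      ∫ y, Metric.infDist y (α : Set (EuclideanSpace ℝ (Fin q))) ^ r ∂ν ≤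
        (∫ y, Metric.infDist y {0} ^ r ∂ν) * ε ^ (1 - x) := by
    intro ε h1 h2
    refine ⟨{0}, by simp, ?_, ?_⟩
    · simpa using Real.one_le_rpow_of_pos_of_le_one_of_nonpos (by positivity) h1 (neg_nonpos.2 hx)
    · rw [Finset.coe_singleton]
      exact le_mul_of_one_le_right
        (integral_nonneg fun _ => Real.rpow_nonneg Metric.infDist_nonneg r)
        (Real.one_le_rpow h2 (by linarith))
  induction n generalizing ε with
  | zero => exact hbase ε hεc (by simpa using hnε)
  | succ n ih =>
    rcases le_or_gt 1 ε with h1 | h1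
    · exact hbase ε hεc h1
    have hstep : ∀ i, _ := fun i => ih (ε := ε / (t i * s i ^ r)) (div_pos hε (hη i).1)
      (by
        rw [le_div_iff₀ (hη i).1]
        refine le_trans ?_ hnε
        rw [pow_succ]
        exact mul_le_mul_of_nonneg_left (hηb i) (pow_nonneg ((hη i).1.le.trans (hηb i)) n))
      (by
        rw [← mul_div_assoc, div_le_one (hη i).1]
        nlinarith [hcη i])
    choose β hβ hcard hint using hstep
    refine ⟨Finset.univ.biUnion fun i => (β i).image (f i), ?_, ?_, ?_⟩
    · exact (Finset.biUnion_nonempty).2 ⟨⟨0, hN⟩, Finset.mem_univ _, (hβ _).image _⟩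
    · calc (((Finset.univ.biUnion fun i => (β i).image (f i)).card : ℕ) : ℝ)
          ≤ ((∑ i, (β i).card : ℕ) : ℝ) := by
            exact_mod_cast Finset.card_biUnion_le.trans
              (Finset.sum_le_sum fun i _ => Finset.card_image_le)
        _ ≤ ∑ i, (c * (ε / (t i * s i ^ r))) ^ (-x) := by
            push_cast
            exact Finset.sum_le_sum fun i _ => hcard i
        _ = (c * ε) ^ (-x) := by
            have : ∀ i, (c * (ε / (t i * s i ^ r))) ^ (-x) =
                (c * ε) ^ (-x) * (t i * s i ^ r) ^ x := fun i => by
              rw [← mul_div_assoc, Real.div_rpow (by positivity) (hη i).1.le,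
                Real.rpow_neg (hη i).1.le, div_inv_eq_mul]
            simp_rw [this, ← Finset.mul_sum, hsum, mul_one]
    · refine (integral_infDist_rpow_le_sum hνc hs hf ht hνss hr
        (β := fun i => (β i : Set (EuclideanSpace ℝ (Fin q)))) (fun i => by simpa using hβ i)
        fun i => ?_).trans ?_
      · rw [← Finset.coe_image]
        exact Finset.coe_subset.2
          (Finset.subset_biUnion_of_mem (fun i => (β i).image (f i)) (Finset.mem_univ i))
      · calc _ ≤ ∑ i, t i * s i ^ r * ((∫ y, Metric.infDist y {0} ^ r ∂ν) *
              (ε / (t i * s i ^ r)) ^ (1 - x)) :=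
              Finset.sum_le_sum fun i _ => mul_le_mul_of_nonneg_left (hint i) (hη i).1.le
          _ = (∫ y, Metric.infDist y {0} ^ r ∂ν) * ε ^ (1 - x) := by
              have : ∀ i, t i * s i ^ r * ((∫ y, Metric.infDist y {0} ^ r ∂ν) *
                  (ε / (t i * s i ^ r)) ^ (1 - x)) =
                  (∫ y, Metric.infDist y {0} ^ r ∂ν) * ε ^ (1 - x) * (t i * s i ^ r) ^ x :=
                  fun i => by
                have hi := (hη i).1
                have := Real.rpow_pos_of_pos hi x
                rw [Real.div_rpow hε.le hi.le, Real.rpow_sub hi, Real.rpow_one]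
                generalize t i * s i ^ r = η at *
                field_simp
              simp_rw [this, ← Finset.mul_sum, hsum, mul_one]

lemma exists_pos_mul_rpow_le_integral_infDist [IsProbabilityMeasure ν]
    (hνc : ∃ K, IsCompact K ∧ ν Kᶜ = 0) (hs : ∀ i, s i ∈ Set.Ioo (0 : ℝ) 1)
    (hf : ∀ i x y, dist (f i x) (f i y) = s i * dist x y)
    {U : Set (EuclideanSpace ℝ (Fin q))} (hUne : U.Nonempty) (hUo : IsOpen U)
    (hU : ∀ i, f i '' U ⊆ U) (hd : Pairwise fun i j => Disjoint (f i '' U) (f j '' U))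
    (ht : ∀ i, 0 < t i) (hνss : ν = ∑ i, ENNReal.ofReal (t i) • ν.map (f i))
    {r : ℝ} (hr : 0 < r) {x : ℝ} (hη : ∀ i, t i * s i ^ r ∈ Set.Ioo (0 : ℝ) 1)
    (hx : 0 < x) (hsum : ∑ i, (t i * s i ^ r) ^ x = 1) :
    ∃ C > 0, ∀ n : ℕ, 1 ≤ n → ∀ α : Finset (EuclideanSpace ℝ (Fin q)), α.Nonempty → α.card ≤ n →
      C * (n : ℝ) ^ (1 - 1 / x) ≤
        ∫ y, Metric.infDist y (α : Set (EuclideanSpace ℝ (Fin q))) ^ r ∂ν := by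
  classical
  have hs0 : ∀ i, 0 < s i := fun i => (hs i).1
  have hspos := prodw_pos hs0
  obtain ⟨m, hm, hm1, hms⟩ := exists_pos_le_one_forall_le hs0
  obtain ⟨c, hc, hc1, hcη⟩ := exists_pos_le_one_forall_le fun i => (hη i).1
  obtain ⟨b, hb, hηb⟩ := exists_lt_one_forall_le fun i => (hη i).2
  obtain ⟨R, hR, hRf, hνR⟩ := exists_invariant_ball hs f hνc
  have hνR1 : ν (Metric.closedBall 0 R) = 1 :=
    (prob_compl_eq_zero_iff Metric.isClosed_closedBall.measurableSet).1 hνR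
  obtain ⟨k, hk⟩ := exists_suffix_separating hs hf hUne hUo hU hd hm hm1 hms
    (R := R) (fun w => norm_wordMap_le hs0 hf hRf w (by simpa using hR.le)) (6 * R)
  refine ⟨prodw (fun i => t i * s i ^ r) k * R ^ r * c * 2 ^ (-(1 / x)),
    by have := prodw_pos (fun i => (hη i).1) k; positivity, fun n hn α hα hαn => ?_⟩
  have hn0 : (0 : ℝ) < n := by exact_mod_cast hn
  set ε : ℝ := (2 * n) ^ (-(1 / x)) with hεdef
  have hε : 0 < ε := by positivity
  have hε1 : ε ≤ 1 := Real.rpow_le_one_of_one_le_of_nonpos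
    (by have : (1 : ℝ) ≤ n := by exact_mod_cast hn
        linarith) (by simpa using hx.le)
  obtain ⟨j, hj⟩ := exists_pow_lt_of_lt_one hε hb
  obtain ⟨Γ, hΓ, hlow, hcard⟩ := exists_antichain_card_ge hη hx.le hsum hc hcη hηb j hε hj.le
    (mul_le_one₀ hc1 hε.le hε1)
  have hcard2 : 2 * n ≤ Γ.card := by
    have : ε ^ (-x) = 2 * n := by
      rw [hεdef, ← Real.rpow_mul (by positivity)]
      field_simp
      simp
    rw [this] at hcard
    exact_mod_cast hcard
  set z : List (Fin N) → EuclideanSpace ℝ (Fin q) := fun σ => wordMap f (σ ++ k) 0 with hz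
  set ρ : List (Fin N) → ℝ := fun σ => R * prodw s (σ ++ k) with hρ
  have hρpos : ∀ σ, 0 < ρ σ := fun σ => mul_pos hR (hspos _)
  have hsep : ∀ σ ∈ Γ, ∀ τ ∈ Γ, σ ≠ τ → 2 * ρ σ + 2 * ρ τ < dist (z σ) (z τ) := by
    intro σ hσ τ hτ hne
    have h1 := hΓ hσ hτ hne
    have h2 := hΓ hτ hσ hne.symm
    rcases le_total (prodw s (τ ++ k)) (prodw s (σ ++ k)) with h | h
    · have h3 := hk σ τ h1 h2 h
      simp only [hρ]
      nlinarith [mul_pos hR (hspos (σ ++ k))]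
    · have h3 := hk τ σ h2 h1 h
      rw [dist_comm] at h3
      simp only [hρ]
      nlinarith [mul_pos hR (hspos (τ ++ k))]
  set near := Γ.filter fun σ => ∃ a ∈ α, dist a (z σ) ≤ 2 * ρ σ with hnear
  have hnearcard : near.card ≤ n := by
    have hch : ∀ σ ∈ near, ∃ a ∈ α, dist a (z σ) ≤ 2 * ρ σ := fun σ hσ =>
      (Finset.mem_filter.1 hσ).2
    choose! a haα ha using hch
    refine (Finset.card_le_card_of_injOn a haα fun σ hσ τ hτ hστ => ?_).trans hαn
    by_contra hne
    have h1 := ha σ hσ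
    have h2 := ha τ hτ
    rw [← hστ] at h2
    have h3 := hsep σ (Finset.mem_filter.1 hσ).1 τ (Finset.mem_filter.1 hτ).1 hne
    linarith [dist_triangle_left (z σ) (z τ) (a σ)]
  set far := Γ.filter fun σ => ¬ ∃ a ∈ α, dist a (z σ) ≤ 2 * ρ σ with hfar
  have hfarcard : n ≤ far.card := by
    have : near.card + far.card = Γ.card := Finset.card_filter_add_card_filter_not _
    omega
  have hint := integrable_infDist_rpow hνc hr (α : Set (EuclideanSpace ℝ (Fin q)))
  have hmeas : ∀ σ, MeasurableSet (Metric.closedBall (z σ) (ρ σ)) := fun σ =>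
    Metric.isClosed_closedBall.measurableSet
  have hpiece : ∀ σ ∈ far, prodw (fun i => t i * s i ^ r) k * R ^ r * (c * ε) ≤
      ∫ y in Metric.closedBall (z σ) (ρ σ),
        Metric.infDist y (α : Set (EuclideanSpace ℝ (Fin q))) ^ r ∂ν := by
    intro σ hσ
    obtain ⟨hσΓ, hσ⟩ := Finset.mem_filter.1 hσ
    push Not at hσ
    have hνball : prodw t (σ ++ k) ≤ ν.real (Metric.closedBall (z σ) (ρ σ)) := by
      have h1 := ofReal_prodw_mul_measure_preimage_le
        (fun i => (continuous_of_dist_eq_mul hs0 hf i).measurable) ht hνss (σ ++ k) (hmeas σ)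
      have h2 : ν (wordMap f (σ ++ k) ⁻¹' Metric.closedBall (z σ) (ρ σ)) = 1 := by
        refine le_antisymm prob_le_one (hνR1 ▸ measure_mono fun y hy => ?_)
        rw [Set.mem_preimage, Metric.mem_closedBall, hz, dist_wordMap hf, hρ, mul_comm]
        exact mul_le_mul_of_nonneg_right hy (hspos _).le
      rw [h2, mul_one] at h1
      exact (ENNReal.ofReal_le_iff_le_toReal (by finiteness)).1 h1
    calc prodw (fun i => t i * s i ^ r) k * R ^ r * (c * ε)
        ≤ prodw (fun i => t i * s i ^ r) k * R ^ r * prodw (fun i => t i * s i ^ r) σ := by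
          have := prodw_pos (fun i => (hη i).1) k
          have := hlow σ hσΓ
          gcongr
      _ = ρ σ ^ r * prodw t (σ ++ k) := by
          rw [hρ, Real.mul_rpow hR.le (hspos _).le, mul_assoc _ (_ ^ r) (prodw t _),
            mul_comm (_ ^ r) (prodw t _), ← prodw_mul_rpow hs0, prodw_append]
          ring
      _ ≤ ρ σ ^ r * ν.real (Metric.closedBall (z σ) (ρ σ)) := by
          have := hρpos σ
          gcongr
      _ ≤ _ := by
          refine setIntegral_ge_of_const_le_real (hmeas σ) (by finiteness) (fun y hy => ?_)
            hint.integrableOn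
          refine Real.rpow_le_rpow (hρpos σ).le ?_ hr.le
          rw [Metric.le_infDist (by simpa using hα)]
          intro a ha
          have h1 := hσ a ha
          rw [Metric.mem_closedBall] at hy
          linarith [dist_triangle_left a (z σ) y]
  calc _ = n * (prodw (fun i => t i * s i ^ r) k * R ^ r * (c * ε)) := by
        rw [hεdef, Real.mul_rpow (by norm_num) hn0.le, sub_eq_add_neg, Real.rpow_add hn0,
          Real.rpow_one]
        ring
    _ ≤ far.card * (prodw (fun i => t i * s i ^ r) k * R ^ r * (c * ε)) := by
        have := prodw_pos (fun i => (hη i).1) k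
        gcongr
    _ ≤ ∑ σ ∈ far, ∫ y in Metric.closedBall (z σ) (ρ σ),
        Metric.infDist y (α : Set (EuclideanSpace ℝ (Fin q))) ^ r ∂ν := by
        rw [← nsmul_eq_mul]
        exact Finset.card_nsmul_le_sum _ _ _ hpiece
    _ = ∫ y in ⋃ σ ∈ far, Metric.closedBall (z σ) (ρ σ),
        Metric.infDist y (α : Set (EuclideanSpace ℝ (Fin q))) ^ r ∂ν := by
        refine (integral_biUnion_finset far (fun σ _ => hmeas σ) ?_
          fun σ _ => hint.integrableOn).symm
        intro σ hσ τ hτ hne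
        refine Metric.closedBall_disjoint_closedBall ?_
        have := hsep σ (Finset.mem_filter.1 hσ).1 τ (Finset.mem_filter.1 hτ).1 hne
        linarith [hρpos σ, hρpos τ]
    _ ≤ _ := setIntegral_le_integral hint
        (Eventually.of_forall fun y => Real.rpow_nonneg Metric.infDist_nonneg r)

lemma exists_mul_rpow_ge_integral_infDist [IsProbabilityMeasure ν]
    (hνc : ∃ K, IsCompact K ∧ ν Kᶜ = 0) (hs : ∀ i, 0 < s i)
    (hf : ∀ i x y, dist (f i x) (f i y) = s i * dist x y)
    (ht : ∀ i, 0 < t i) (hνss : ν = ∑ i, ENNReal.ofReal (t i) • ν.map (f i))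
    {r : ℝ} (hr : 0 < r) {x : ℝ} (hη : ∀ i, t i * s i ^ r ∈ Set.Ioo (0 : ℝ) 1)
    (hx : 0 < x) (hx1 : x ≤ 1) (hsum : ∑ i, (t i * s i ^ r) ^ x = 1) (hN : 0 < N) :
    ∃ C ≥ 0, ∀ n : ℕ, 1 ≤ n → ∃ α : Finset (EuclideanSpace ℝ (Fin q)), α.Nonempty ∧ α.card ≤ n ∧
      ∫ y, Metric.infDist y (α : Set (EuclideanSpace ℝ (Fin q))) ^ r ∂ν ≤
        C * (n : ℝ) ^ (1 - 1 / x) := by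
  obtain ⟨c, hc, hc1, hcη⟩ := exists_pos_le_one_forall_le fun i => (hη i).1
  obtain ⟨b, hb, hηb⟩ := exists_lt_one_forall_le fun i => (hη i).2
  refine ⟨(∫ y, Metric.infDist y {0} ^ r ∂ν) * c⁻¹ ^ (1 - x),
    mul_nonneg (integral_nonneg fun _ => Real.rpow_nonneg Metric.infDist_nonneg r)
      (by positivity), fun n hn => ?_⟩
  have hn1 : (1 : ℝ) ≤ n := by exact_mod_cast hn
  have hn0 : (0 : ℝ) < n := by linarith
  have hε : 0 < c⁻¹ * (n : ℝ) ^ (-(1 / x)) := by positivity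
  have hcε : c * (c⁻¹ * (n : ℝ) ^ (-(1 / x))) = (n : ℝ) ^ (-(1 / x)) := by field_simp
  obtain ⟨j, hj⟩ := exists_pow_lt_of_lt_one hε hb
  obtain ⟨α, hα, hcard, hint⟩ := exists_finset_integral_infDist_rpow_le hνc hs hf ht hνss hr hη
    hx.le hx1 hsum hc hcη hηb hN j hε hj.le
    (hcε.trans_le (Real.rpow_le_one_of_one_le_of_nonpos hn1 (neg_nonpos.2 (by positivity))))
  refine ⟨α, hα, ?_, hint.trans_eq ?_⟩
  · rw [hcε, ← Real.rpow_mul hn0.le, neg_mul_neg, one_div_mul_cancel hx.ne', Real.rpow_one]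
      at hcard
    exact_mod_cast hcard
  · rw [Real.mul_rpow (by positivity) (by positivity), ← Real.rpow_mul hn0.le, ← mul_assoc]
    congr 2
    field_simp
    ring

end SelfSimilarMeasure

/-- Remark (Zhu): under the OSC, if `p_i = (1-p_0) t_i` for all `i` (so `μ` is the
self-similar measure of `(f_i, t_i)`), then `ξ_{1,r} > ξ_{2,r}`, and consequently
`0 < liminf n^{1/ξ_{1,r}} e_{n,r}(μ)` and `limsup n^{1/ξ_{1,r}} e_{n,r}(μ) < ∞`. -/
theorem self_similar_case_quantization_coefficients
    (q N : ℕ) (hq : 1 ≤ q) (hN : 2 ≤ N) (r : ℝ) (hr : 0 < r)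
    (f : Fin N → EuclideanSpace ℝ (Fin q) → EuclideanSpace ℝ (Fin q))
    (s : Fin N → ℝ) (hs : ∀ i, s i ∈ Set.Ioo (0 : ℝ) 1)
    (hf : ∀ i x y, dist (f i x) (f i y) = s i * dist x y)
    (E : Set (EuclideanSpace ℝ (Fin q)))
    (hEcpt : IsCompact E) (hEne : E.Nonempty) (hEss : E = ⋃ i, f i '' E)
    (hEdiam : Metric.diam E = 1)
    (hOSC : ∃ U : Set (EuclideanSpace ℝ (Fin q)), U.Nonempty ∧ IsOpen U ∧
      (∀ i, f i '' U ⊆ U) ∧ Pairwise fun i j => Disjoint (f i '' U) (f j '' U))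
    (t : Fin N → ℝ) (ht : ∀ i, 0 < t i) (ht1 : ∑ i, t i = 1)
    (ν : Measure (EuclideanSpace ℝ (Fin q))) (hνP : IsProbabilityMeasure ν)
    (hνc : ∃ K, IsCompact K ∧ ν Kᶜ = 0)
    (hνss : ν = ∑ i, ENNReal.ofReal (t i) • ν.map (f i))
    (p0 : ℝ) (p : Fin N → ℝ) (hp0 : 0 < p0) (hp : ∀ i, 0 < p i)
    (hp1 : p0 + ∑ i, p i = 1)
    (μ : Measure (EuclideanSpace ℝ (Fin q))) (hμP : IsProbabilityMeasure μ)
    (hμc : ∃ K, IsCompact K ∧ μ Kᶜ = 0)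
    (hμss : μ = ENNReal.ofReal p0 • ν + ∑ i, ENNReal.ofReal (p i) • μ.map (f i))
    (ξ1 ξ2 : ℝ) (hξ1 : 0 < ξ1) (hξ2 : 0 < ξ2)
    (hξ1e : ∑ i, (t i * s i ^ r) ^ (ξ1 / (ξ1 + r)) = 1)
    (hξ2e : ∑ i, (p i * s i ^ r) ^ (ξ2 / (ξ2 + r)) = 1)
    (hpdef : ∀ i, p i = (1 - p0) * t i) :
    ξ2 < ξ1 ∧
    0 < liminf (fun n : ℕ =>
      (((n : ℝ) ^ (1 / ξ1) * quantErr μ n r : ℝ) : EReal)) atTop ∧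
    limsup (fun n : ℕ =>
      (((n : ℝ) ^ (1 / ξ1) * quantErr μ n r : ℝ) : EReal)) atTop < ⊤ := by
  have hN0 : 0 < N := by omega
  have i₀ : Fin N := ⟨0, hN0⟩
  have hp0' : p0 < 1 := by
    have := Finset.sum_pos (fun i _ => hp i) ⟨i₀, Finset.mem_univ i₀⟩
    linarith
  have hs0 : ∀ i, 0 < s i := fun i => (hs i).1
  have hη : ∀ i, t i * s i ^ r ∈ Set.Ioo (0 : ℝ) 1 := fun i => by
    have h1 := Real.rpow_pos_of_pos (hs0 i) r
    have h2 := Real.rpow_lt_one (hs0 i).le (hs i).2 hr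
    have h3 : t i ≤ 1 := ht1 ▸ Finset.single_le_sum (fun j _ => (ht j).le) (Finset.mem_univ i)
    exact ⟨mul_pos (ht i) h1, by nlinarith [ht i]⟩
  have hμν : μ = ν := eq_of_inhomogeneous_selfSimilar
    (fun i => (continuous_of_dist_eq_mul hs0 hf i).measurable) ht ht1 hνss hp0 hp0'
    (by simpa only [← hpdef] using hμss)
  subst hμν
  have hx : 0 < ξ1 / (ξ1 + r) := by positivity
  have hx1 : ξ1 / (ξ1 + r) ≤ 1 := (div_le_one (by positivity)).2 (by linarith)
  have hexp : 1 - 1 / (ξ1 / (ξ1 + r)) = -(r / ξ1) := by field_simp; ring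
  have hscale : ∀ (C : ℝ), 0 ≤ C → ∀ n : ℕ, 1 ≤ n →
      (n : ℝ) ^ (1 / ξ1) * (C * (n : ℝ) ^ (-(r / ξ1))) ^ (1 / r) = C ^ (1 / r) := by
    intro C hC n hn
    have hn0 : (0 : ℝ) < n := by exact_mod_cast hn
    have h1 : -(r / ξ1) * (1 / r) = -(1 / ξ1) := by field_simp
    rw [Real.mul_rpow hC (by positivity), ← Real.rpow_mul hn0.le, h1, Real.rpow_neg hn0.le]
    have := Real.rpow_pos_of_pos hn0 (1 / ξ1)
    field_simp
  obtain ⟨U, hUne, hUo, hU, hd⟩ := hOSC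
  obtain ⟨c, hc, hlow⟩ := exists_pos_mul_rpow_le_integral_infDist hνc hs hf hUne hUo hU hd ht
    hνss hr hη hx hξ1e
  obtain ⟨C, hC, hupp⟩ := exists_mul_rpow_ge_integral_infDist hνc hs0 hf ht hνss hr hη hx hx1
    hξ1e hN0
  rw [hexp] at hlow hupp
  refine ⟨?_, ?_, ?_⟩
  · by_contra! hle
    have hxle : ξ1 / (ξ1 + r) ≤ ξ2 / (ξ2 + r) := by
      rw [div_le_div_iff₀ (by positivity) (by positivity)]
      nlinarith
    have hlt : ∑ i, (p i * s i ^ r) ^ (ξ2 / (ξ2 + r)) < ∑ i, (t i * s i ^ r) ^ (ξ1 / (ξ1 + r)) := by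
      refine Finset.sum_lt_sum_of_nonempty ⟨i₀, Finset.mem_univ i₀⟩ fun i _ => ?_
      have hsr := Real.rpow_pos_of_pos (hs0 i) r
      calc (p i * s i ^ r) ^ (ξ2 / (ξ2 + r)) < (t i * s i ^ r) ^ (ξ2 / (ξ2 + r)) := by
            refine Real.rpow_lt_rpow (mul_pos (hp i) hsr).le ?_ (by positivity)
            refine mul_lt_mul_of_pos_right ?_ hsr
            rw [hpdef]
            nlinarith [ht i]
        _ ≤ _ := Real.rpow_le_rpow_of_exponent_ge (hη i).1 (hη i).2.le hxle
    rw [hξ1e, hξ2e] at hlt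
    exact lt_irrefl _ hlt
  · have hpos : (0 : EReal) < ((c ^ (1 / r) : ℝ) : EReal) :=
      EReal.coe_pos.2 (Real.rpow_pos_of_pos hc _)
    refine hpos.trans_le (le_liminf_of_le (by isBoundedDefault) ?_)
    filter_upwards [eventually_ge_atTop 1] with n hn
    have hn0 : (0 : ℝ) < n := by exact_mod_cast hn
    rw [EReal.coe_le_coe_iff, ← hscale c hc.le n hn]
    refine mul_le_mul_of_nonneg_left ?_ (by positivity)
    refine le_csInf (Set.Nonempty.image _ ⟨{0}, by simp, by simpa using hn⟩) ?_
    rintro _ ⟨α, ⟨hα, hαn⟩, rfl⟩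
    exact Real.rpow_le_rpow (by positivity) (hlow n hn α hα hαn) (by positivity)
  · refine lt_of_le_of_lt (b := ((C ^ (1 / r) : ℝ) : EReal))
      (limsup_le_of_le (by isBoundedDefault) ?_) (EReal.coe_lt_top _)
    filter_upwards [eventually_ge_atTop 1] with n hn
    have hn0 : (0 : ℝ) < n := by exact_mod_cast hn
    rw [EReal.coe_le_coe_iff, ← hscale C hC n hn]
    refine mul_le_mul_of_nonneg_left ?_ (by positivity)
    have hnonneg : ∀ α : Finset (EuclideanSpace ℝ (Fin q)),
        0 ≤ ∫ y, Metric.infDist y (α : Set (EuclideanSpace ℝ (Fin q))) ^ r ∂μ := fun α =>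
      integral_nonneg fun _ => Real.rpow_nonneg Metric.infDist_nonneg r
    obtain ⟨α, hα, hαn, hint⟩ := hupp n hn
    refine le_trans (csInf_le ⟨0, ?_⟩ ⟨α, ⟨hα, hαn⟩, rfl⟩)
      (Real.rpow_le_rpow (hnonneg α) hint (by positivity))
    rintro _ ⟨β, -, rfl⟩
    exact Real.rpow_nonneg (hnonneg β) _
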